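/- arXiv:2602.23615 — 3 statements merged into one kernel-verified Lean document; each statement's English description precedes it below -/
import Mathlib

section
/- Fix a, b ∈ (0,1). The function t ↦ I(t) is strictly decreasing on the interval [max(0, a+b−1), a·b] and strictly increasing on the interval [a·b, min(a, b)]; in particular I attains its minimum over the feasible interval exactly at the independence point t = a·b. -/
/-- Mutual information `I(t)` between grounding correctness `L` (first coordinate,
marginal `(a, 1-a)`) and answer correctness `R` (second coordinate, marginal `(1-b, b)`)
under the joint distribution `p_t(0,1) = t`, `p_t(0,0) = a - t`, `p_t(1,1) = b - t`,
`p_t(1,0) = 1 - a - b + t`, using the natural logarithm.  The convention `0 · log 0 = 0`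
holds automatically since `Real.log 0 = 0`. -/
noncomputable def mutualInfo (a b t : ℝ) : ℝ :=
  t * Real.log (t / (a * b)) +
  (a - t) * Real.log ((a - t) / (a * (1 - b))) +
  (b - t) * Real.log ((b - t) / ((1 - a) * b)) +
  (1 - a - b + t) * Real.log ((1 - a - b + t) / ((1 - a) * (1 - b)))

theorem continuous_mul_log_div {c : ℝ} (hc : c ≠ 0) :
    Continuous fun x : ℝ => x * Real.log (x / c) := by
  have h : Continuous fun x : ℝ => c * ((x / c) * Real.log (x / c)) :=
    (Real.continuous_mul_log.comp (continuous_id.div_const c)).const_mul c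
  convert h using 2 with x
  rw [← mul_assoc, mul_div_cancel₀ x hc]

theorem hasDerivAt_mul_log_div {c x : ℝ} (hc : c ≠ 0) (hx : x ≠ 0) :
    HasDerivAt (fun x : ℝ => x * Real.log (x / c)) (Real.log (x / c) + 1) x := by
  refine ((hasDerivAt_id' x).mul
    (((hasDerivAt_id' x).div_const c).log (div_ne_zero hx hc))).congr_deriv ?_
  field_simp

theorem continuous_mutualInfo {a b : ℝ} (ha0 : 0 < a) (ha1 : a < 1) (hb0 : 0 < b)
    (hb1 : b < 1) : Continuous (mutualInfo a b) := by
  have ha' := sub_pos.2 ha1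
  have hb' := sub_pos.2 hb1
  exact (((continuous_mul_log_div (mul_pos ha0 hb0).ne').add
    ((continuous_mul_log_div (mul_pos ha0 hb').ne').comp (continuous_sub_left a))).add
    ((continuous_mul_log_div (mul_pos ha' hb0).ne').comp (continuous_sub_left b))).add
    ((continuous_mul_log_div (mul_pos ha' hb').ne').comp (continuous_const_add (1 - a - b)))

theorem hasDerivAt_mutualInfo {a b t : ℝ} (ha0 : 0 < a) (ha1 : a < 1) (hb0 : 0 < b)
    (hb1 : b < 1) (h₁ : t ≠ 0) (h₂ : a - t ≠ 0) (h₃ : b - t ≠ 0) (h₄ : 1 - a - b + t ≠ 0) :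
    HasDerivAt (mutualInfo a b)
      (Real.log (t / (a * b)) - Real.log ((a - t) / (a * (1 - b))) -
        Real.log ((b - t) / ((1 - a) * b)) +
        Real.log ((1 - a - b + t) / ((1 - a) * (1 - b)))) t := by
  have ha' := sub_pos.2 ha1
  have hb' := sub_pos.2 hb1
  have h := (((hasDerivAt_mul_log_div (mul_pos ha0 hb0).ne' h₁).add
    ((hasDerivAt_mul_log_div (mul_pos ha0 hb').ne' h₂).comp t
      ((hasDerivAt_id' t).const_sub a))).add
    ((hasDerivAt_mul_log_div (mul_pos ha' hb0).ne' h₃).comp t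
      ((hasDerivAt_id' t).const_sub b))).add
    ((hasDerivAt_mul_log_div (mul_pos ha' hb').ne' h₄).comp t
      ((hasDerivAt_id' t).const_add (1 - a - b)))
  refine HasDerivAt.congr_deriv h ?_
  ring

theorem strictAntiOn_mutualInfo {a b : ℝ} (ha0 : 0 < a) (ha1 : a < 1) (hb0 : 0 < b)
    (hb1 : b < 1) : StrictAntiOn (mutualInfo a b) (Set.Icc (max 0 (a + b - 1)) (a * b)) := by
  have ha' := sub_pos.2 ha1
  have hb' := sub_pos.2 hb1
  have hab := mul_pos ha0 hb0
  have hab' := mul_pos ha0 hb'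
  have ha'b := mul_pos ha' hb0
  have ha'b' := mul_pos ha' hb'
  refine strictAntiOn_of_deriv_neg (convex_Icc _ _)
    (continuous_mutualInfo ha0 ha1 hb0 hb1).continuousOn fun t ht => ?_
  rw [interior_Icc, Set.mem_Ioo, max_lt_iff] at ht
  obtain ⟨⟨h0, h1⟩, h2⟩ := ht
  have h₂ : 0 < a - t := by linarith
  have h₃ : 0 < b - t := by linarith
  have h₄ : 0 < 1 - a - b + t := by linarith
  rw [(hasDerivAt_mutualInfo ha0 ha1 hb0 hb1 h0.ne' h₂.ne' h₃.ne' h₄.ne').deriv]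
  have l₁ := Real.log_neg (div_pos h0 hab) ((div_lt_one hab).2 h2)
  have l₂ := Real.log_pos ((one_lt_div hab').2 (by linarith : a * (1 - b) < a - t))
  have l₃ := Real.log_pos ((one_lt_div ha'b).2 (by linarith : (1 - a) * b < b - t))
  have l₄ := Real.log_neg (div_pos h₄ ha'b')
    ((div_lt_one ha'b').2 (by linarith : 1 - a - b + t < (1 - a) * (1 - b)))
  linarith

theorem strictMonoOn_mutualInfo {a b : ℝ} (ha0 : 0 < a) (ha1 : a < 1) (hb0 : 0 < b)
    (hb1 : b < 1) : StrictMonoOn (mutualInfo a b) (Set.Icc (a * b) (min a b)) := by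
  have ha' := sub_pos.2 ha1
  have hb' := sub_pos.2 hb1
  have hab := mul_pos ha0 hb0
  have hab' := mul_pos ha0 hb'
  have ha'b := mul_pos ha' hb0
  have ha'b' := mul_pos ha' hb'
  refine strictMonoOn_of_deriv_pos (convex_Icc _ _)
    (continuous_mutualInfo ha0 ha1 hb0 hb1).continuousOn fun t ht => ?_
  rw [interior_Icc, Set.mem_Ioo, lt_min_iff] at ht
  obtain ⟨h2, hta, htb⟩ := ht
  have h₁ : 0 < t := hab.trans h2
  have h₂ : 0 < a - t := by linarith
  have h₃ : 0 < b - t := by linarith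
  have h₄ : 0 < 1 - a - b + t := by linarith
  rw [(hasDerivAt_mutualInfo ha0 ha1 hb0 hb1 h₁.ne' h₂.ne' h₃.ne' h₄.ne').deriv]
  have l₁ := Real.log_pos ((one_lt_div hab).2 h2)
  have l₂ := Real.log_neg (div_pos h₂ hab')
    ((div_lt_one hab').2 (by linarith : a - t < a * (1 - b)))
  have l₃ := Real.log_neg (div_pos h₃ ha'b)
    ((div_lt_one ha'b).2 (by linarith : b - t < (1 - a) * b))
  have l₄ := Real.log_pos
    ((one_lt_div ha'b').2 (by linarith : (1 - a) * (1 - b) < 1 - a - b + t))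
  linarith

/-- `I` is strictly decreasing on `[max 0 (a+b-1), a·b]`, strictly increasing on
`[a·b, min a b]`, and attains its minimum over the feasible interval exactly at the
independence point `t = a·b`. -/
theorem mutualInfo_strictAntiOn_strictMonoOn_min
    (a b : ℝ) (ha0 : 0 < a) (ha1 : a < 1) (hb0 : 0 < b) (hb1 : b < 1) :
    StrictAntiOn (mutualInfo a b) (Set.Icc (max 0 (a + b - 1)) (a * b)) ∧
    StrictMonoOn (mutualInfo a b) (Set.Icc (a * b) (min a b)) ∧
    (∀ t ∈ Set.Icc (max 0 (a + b - 1)) (min a b), t ≠ a * b →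
      mutualInfo a b (a * b) < mutualInfo a b t) := by
  have hanti := strictAntiOn_mutualInfo ha0 ha1 hb0 hb1
  have hmono := strictMonoOn_mutualInfo ha0 ha1 hb0 hb1
  refine ⟨hanti, hmono, fun t ⟨hl, hu⟩ hne => ?_⟩
  rcases lt_or_gt_of_ne hne with h | h
  · exact hanti ⟨hl, h.le⟩ ⟨hl.trans h.le, le_rfl⟩ h
  · exact hmono ⟨le_rfl, h.le.trans hu⟩ ⟨h.le, hu⟩ h
end

section
/- Fix a, b ∈ (0,1). The function t ↦ I(t) is strictly convex on the open feasible interval (max(0, a+b−1), min(a, b)). -/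
/-- The function `t ↦ u t * log (u t / c)` is strictly convex wherever the nonconstant affine
function `u t = m * t + k` is nonnegative. -/
theorem strictConvexOn_affine_mul_log_div {s : Set ℝ} (hs : Convex ℝ s) {m k c : ℝ}
    (hm : m ≠ 0) (hc : 0 < c) (hnonneg : ∀ t ∈ s, 0 ≤ m * t + k) :
    StrictConvexOn ℝ s (fun t ↦ (m * t + k) * Real.log ((m * t + k) / c)) := by
  refine ⟨hs, fun x hx y hy hxy p q hp hq hpq ↦ ?_⟩
  have hne : (m * x + k) / c ≠ (m * y + k) / c := by
    intro h
    rw [div_left_inj' hc.ne', add_left_inj] at h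
    exact hxy (mul_left_cancel₀ hm h)
  have key := Real.strictConvexOn_mul_log.2
    (Set.mem_Ici.2 (div_nonneg (hnonneg x hx) hc.le))
    (Set.mem_Ici.2 (div_nonneg (hnonneg y hy) hc.le)) hne hp hq hpq
  simp only [smul_eq_mul] at key ⊢
  have affine : p * ((m * x + k) / c) + q * ((m * y + k) / c) =
      (m * (p * x + q * y) + k) / c := by
    rw [eq_sub_of_add_eq hpq]
    ring
  rw [affine] at key
  calc
    _ = c * ((m * (p * x + q * y) + k) / c *
        Real.log ((m * (p * x + q * y) + k) / c)) := by
      rw [← mul_assoc, mul_div_cancel₀ _ hc.ne']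
    _ < c * _ := mul_lt_mul_of_pos_left key hc
    _ = _ := by
      field_simp

/-- `t ↦ I(t)` is strictly convex on the open feasible interval
`(max 0 (a+b-1), min a b)`. -/
theorem mutualInfo_strictConvexOn
    (a b : ℝ) (ha0 : 0 < a) (ha1 : a < 1) (hb0 : 0 < b) (hb1 : b < 1) :
    StrictConvexOn ℝ (Set.Ioo (max 0 (a + b - 1)) (min a b)) (mutualInfo a b) := by
  have ha : 0 < 1 - a := sub_pos.2 ha1
  have hb : 0 < 1 - b := sub_pos.2 hb1
  have hs : Convex ℝ (Set.Ioo (max 0 (a + b - 1)) (min a b)) := convex_Ioo _ _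
  have hbounds : ∀ t ∈ Set.Ioo (max 0 (a + b - 1)) (min a b),
      (0 < t ∧ a + b - 1 < t) ∧ t < a ∧ t < b :=
    fun t ht ↦ ⟨max_lt_iff.1 ht.1, lt_min_iff.1 ht.2⟩
  have h₀₁ := strictConvexOn_affine_mul_log_div hs (m := 1) (k := 0) one_ne_zero
    (mul_pos ha0 hb0) fun t ht ↦ by
      obtain ⟨⟨_, _⟩, _, _⟩ := hbounds t ht
      linarith
  have h₀₀ := strictConvexOn_affine_mul_log_div hs (m := -1) (k := a) (by norm_num)
    (mul_pos ha0 hb) fun t ht ↦ by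
      obtain ⟨⟨_, _⟩, _, _⟩ := hbounds t ht
      linarith
  have h₁₁ := strictConvexOn_affine_mul_log_div hs (m := -1) (k := b) (by norm_num)
    (mul_pos ha hb0) fun t ht ↦ by
      obtain ⟨⟨_, _⟩, _, _⟩ := hbounds t ht
      linarith
  have h₁₀ := strictConvexOn_affine_mul_log_div hs (m := 1) (k := 1 - a - b) one_ne_zero
    (mul_pos ha hb) fun t ht ↦ by
      obtain ⟨⟨_, _⟩, _, _⟩ := hbounds t ht
      linarith
  refine (((h₀₁.add h₀₀).add h₁₁).add h₁₀).congr fun t _ ↦ ?_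
  simp only [mutualInfo, Pi.add_apply, one_mul, add_zero, neg_mul, neg_add_eq_sub]
  rw [add_comm t (1 - a - b)]
end

section
/- Fix a, b ∈ (0,1). For t in the feasible interval, let H(L|R)(t) denote the conditional Shannon entropy of the first coordinate given the second under the joint distribution p_t, i.e. H(L|R)(t) = −∑_{j∈{0,1}} ∑_{i∈{0,1}} p_t(i,j) · log( p_t(i,j) / marginal_R(j) ) with the convention 0·log 0 = 0 and natural logarithm. Then H(L|R)(t) = ( −a·log a − (1−a)·log(1−a) ) − I(t); consequently, for max(0, a+b−1) ≤ t' < t ≤ a·b one has H(L|R)(t') < H(L|R)(t), i.e. a strictly smaller misspecification probability P(L=0, R=1) (below the independence value) yields strictly smaller conditional entropy of grounding correctness given answer correctness. -/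
/-- Conditional Shannon entropy `H(L|R)(t)` of the first coordinate given the second
under `p_t`:  `H(L|R)(t) = -∑_{i,j} p_t(i,j) · log(p_t(i,j) / marginal_R(j))`, where
`marginal_R = (1-b, b)`, with natural logarithm and the convention `0 · log 0 = 0`. -/
noncomputable def condEntropyLR (a b t : ℝ) : ℝ :=
  -(t * Real.log (t / b) +
    (a - t) * Real.log ((a - t) / (1 - b)) +
    (b - t) * Real.log ((b - t) / b) +
    (1 - a - b + t) * Real.log ((1 - a - b + t) / (1 - b)))

theorem Real.mul_log_div (x : ℝ) {y : ℝ} (hy : y ≠ 0) :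
    x * Real.log (x / y) = x * Real.log x - x * Real.log y := by
  rcases eq_or_ne x 0 with rfl | hx
  · simp
  · rw [Real.log_div hx hy]
    ring

theorem condEntropyLR_eq_sub_mutualInfo {a b : ℝ} (ha0 : a ≠ 0) (ha1 : 1 - a ≠ 0)
    (hb0 : b ≠ 0) (hb1 : 1 - b ≠ 0) (t : ℝ) :
    condEntropyLR a b t =
      (-(a * Real.log a) - (1 - a) * Real.log (1 - a)) - mutualInfo a b t := by
  simp only [condEntropyLR, mutualInfo, Real.mul_log_div _ (mul_ne_zero ha0 hb0),
    Real.mul_log_div _ (mul_ne_zero ha0 hb1), Real.mul_log_div _ (mul_ne_zero ha1 hb0),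
    Real.mul_log_div _ (mul_ne_zero ha1 hb1), Real.mul_log_div _ hb0, Real.mul_log_div _ hb1,
    Real.log_mul ha0 hb0, Real.log_mul ha0 hb1, Real.log_mul ha1 hb0, Real.log_mul ha1 hb1]
  ring

theorem condEntropyLR_eq_negMulLog {a b : ℝ} (hb0 : b ≠ 0) (hb1 : 1 - b ≠ 0) (t : ℝ) :
    condEntropyLR a b t =
      Real.negMulLog t + Real.negMulLog (a - t) + Real.negMulLog (b - t) +
        Real.negMulLog (1 - a - b + t) + (b * Real.log b + (1 - b) * Real.log (1 - b)) := by
  simp only [condEntropyLR, Real.negMulLog, Real.mul_log_div _ hb0, Real.mul_log_div _ hb1]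
  ring

theorem continuous_condEntropyLR {a b : ℝ} (hb0 : b ≠ 0) (hb1 : 1 - b ≠ 0) :
    Continuous (condEntropyLR a b) := by
  rw [funext (condEntropyLR_eq_negMulLog (a := a) hb0 hb1)]
  fun_prop

theorem hasDerivAt_condEntropyLR {a b t : ℝ} (hb0 : b ≠ 0) (hb1 : 1 - b ≠ 0)
    (h01 : t ≠ 0) (h00 : a - t ≠ 0) (h11 : b - t ≠ 0) (h10 : 1 - a - b + t ≠ 0) :
    HasDerivAt (condEntropyLR a b)
      (Real.log ((a - t) * (b - t)) - Real.log (t * (1 - a - b + t))) t := by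
  rw [funext (condEntropyLR_eq_negMulLog (a := a) hb0 hb1), Real.log_mul h00 h11,
    Real.log_mul h01 h10]
  have d00 := (Real.hasDerivAt_negMulLog h00).comp t ((hasDerivAt_id t).const_sub a)
  have d11 := (Real.hasDerivAt_negMulLog h11).comp t ((hasDerivAt_id t).const_sub b)
  have d10 := (Real.hasDerivAt_negMulLog h10).comp t ((hasDerivAt_id t).const_add (1 - a - b))
  refine (((((Real.hasDerivAt_negMulLog h01).add d00).add d11).add d10).add_const
    (b * Real.log b + (1 - b) * Real.log (1 - b))).congr_deriv ?_
  ring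

theorem strictMonoOn_condEntropyLR {a b : ℝ} (ha0 : 0 < a) (ha1 : a < 1) (hb0 : 0 < b)
    (hb1 : b < 1) :
    StrictMonoOn (condEntropyLR a b) (Set.Icc (max 0 (a + b - 1)) (a * b)) := by
  have hb0' : b ≠ 0 := hb0.ne'
  have hb1' : 1 - b ≠ 0 := (sub_pos.2 hb1).ne'
  refine strictMonoOn_of_deriv_pos (convex_Icc _ _)
    (continuous_condEntropyLR hb0' hb1').continuousOn fun t ht => ?_
  rw [interior_Icc, Set.mem_Ioo, max_lt_iff] at ht
  obtain ⟨⟨h0, h1⟩, h2⟩ := ht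
  have h00 : 0 < a - t := by nlinarith
  have h11 : 0 < b - t := by nlinarith
  have h10 : 0 < 1 - a - b + t := by linarith
  rw [(hasDerivAt_condEntropyLR hb0' hb1' h0.ne' h00.ne' h11.ne' h10.ne').deriv, sub_pos]
  exact Real.log_lt_log (mul_pos h0 h10) (by linarith)

/-- `H(L|R)(t) = H(L) - I(t)` on the feasible interval, where
`H(L) = -a·log a - (1-a)·log(1-a)`; consequently, for
`max 0 (a+b-1) ≤ t' < t ≤ a·b` one has `H(L|R)(t') < H(L|R)(t)`. -/
theorem condEntropyLR_eq_and_strict_lt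
    (a b : ℝ) (ha0 : 0 < a) (ha1 : a < 1) (hb0 : 0 < b) (hb1 : b < 1) :
    (∀ t ∈ Set.Icc (max 0 (a + b - 1)) (min a b),
      condEntropyLR a b t =
        (-(a * Real.log a) - (1 - a) * Real.log (1 - a)) - mutualInfo a b t) ∧
    (∀ t' t : ℝ, max 0 (a + b - 1) ≤ t' → t' < t → t ≤ a * b →
      condEntropyLR a b t' < condEntropyLR a b t) := by
  refine ⟨fun t _ => condEntropyLR_eq_sub_mutualInfo ha0.ne' (sub_pos.2 ha1).ne' hb0.ne'
    (sub_pos.2 hb1).ne' t, fun t' t h0 hlt h1 => ?_⟩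
  exact strictMonoOn_condEntropyLR ha0 ha1 hb0 hb1 ⟨h0, hlt.le.trans h1⟩
    ⟨h0.trans hlt.le, h1⟩ hlt
end
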